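/- arXiv:1002.2540 — 8 statements merged into one kernel-verified Lean document; each statement's English description precedes it below -/
import Mathlib

section
/- Let H be a finite-dimensional complex vector space and ψ ∈ H ⊗ H a bipartite state. Then ψ is SLOCC-maximal if and only if there exists a ℂ-linear functional Φ : H ⊗ H → ℂ such that for every u ∈ H one has (Φ ⊗ id_H)(u ⊗ ψ) = u, where u ⊗ ψ is regarded as an element of (H ⊗ H) ⊗ H via the canonical associativity isomorphism. -/
open TensorProduct

noncomputable section

variable {H : Type*} [AddCommGroup H] [Module ℂ H]

/-- SLOCC preorder for bipartite states: `φ ⪯ ψ`. -/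
def SLOCCLe2 (φ ψ : H ⊗[ℂ] H) : Prop :=
  ∃ A B : H →ₗ[ℂ] H, φ = TensorProduct.map A B ψ

/-- SLOCC equivalence for bipartite states. -/
def SLOCCEquiv2 (φ ψ : H ⊗[ℂ] H) : Prop :=
  ∃ A B : H ≃ₗ[ℂ] H, φ = TensorProduct.map A.toLinearMap B.toLinearMap ψ

/-- A bipartite state `ψ` is SLOCC-maximal if every `φ` with `ψ ⪯ φ` satisfies `φ ∼ ψ`. -/
def SLOCCMaximal2 (ψ : H ⊗[ℂ] H) : Prop :=
  ∀ φ : H ⊗[ℂ] H, SLOCCLe2 ψ φ → SLOCCEquiv2 φ ψ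

/-- Contraction of the first tensor factor of a tripartite state by a functional `ξ`,
i.e. `ξ ⊗ id ⊗ id`. -/
def contr1 (ξ : H →ₗ[ℂ] ℂ) : (H ⊗[ℂ] H) ⊗[ℂ] H →ₗ[ℂ] H ⊗[ℂ] H :=
  TensorProduct.map
    ((TensorProduct.lid ℂ H).toLinearMap ∘ₗ TensorProduct.map ξ LinearMap.id) LinearMap.id

/-- Contraction of the second tensor factor of a tripartite state by a functional `ξ`,
i.e. `id ⊗ ξ ⊗ id`. -/
def contr2 (ξ : H →ₗ[ℂ] ℂ) : (H ⊗[ℂ] H) ⊗[ℂ] H →ₗ[ℂ] H ⊗[ℂ] H :=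
  TensorProduct.map
    ((TensorProduct.rid ℂ H).toLinearMap ∘ₗ TensorProduct.map LinearMap.id ξ) LinearMap.id

/-- Contraction of the third tensor factor of a tripartite state by a functional `ξ`,
i.e. `id ⊗ id ⊗ ξ`. -/
def contr3 (ξ : H →ₗ[ℂ] ℂ) : (H ⊗[ℂ] H) ⊗[ℂ] H →ₗ[ℂ] H ⊗[ℂ] H :=
  (TensorProduct.rid ℂ (H ⊗[ℂ] H)).toLinearMap ∘ₗ TensorProduct.map LinearMap.id ξ

/-- A tripartite state is strongly SLOCC-maximal if for some functionals `ξ₁, ξ₂, ξ₃`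
the bipartite states `(ξ₁⊗id⊗id)ψ`, `(id⊗ξ₂⊗id)ψ`, `(id⊗id⊗ξ₃)ψ` are SLOCC-maximal. -/
def StronglySLOCCMaximal (ψ : (H ⊗[ℂ] H) ⊗[ℂ] H) : Prop :=
  ∃ ξ₁ ξ₂ ξ₃ : H →ₗ[ℂ] ℂ,
    SLOCCMaximal2 (contr1 ξ₁ ψ) ∧ SLOCCMaximal2 (contr2 ξ₂ ψ) ∧ SLOCCMaximal2 (contr3 ξ₃ ψ)

open Module in
/-- The identification of a bipartite state `∑ vᵢ ⊗ wᵢ` with the linear map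
`ξ ↦ ∑ ξ(vᵢ) wᵢ` from the dual of `H` to `H`. -/
def stateHomEquiv [FiniteDimensional ℂ H] : H ⊗[ℂ] H ≃ₗ[ℂ] (Dual ℂ H →ₗ[ℂ] H) :=
  TensorProduct.congr (evalEquiv ℂ H) (LinearEquiv.refl ℂ H) ≪≫ₗ
    dualTensorHomEquiv ℂ (Dual ℂ H) H

@[simp]
theorem stateHomEquiv_tmul [FiniteDimensional ℂ H] (v w : H) (ξ : Module.Dual ℂ H) :
    stateHomEquiv (v ⊗ₜ[ℂ] w) ξ = ξ v • w := by
  simp [stateHomEquiv]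

theorem stateHomEquiv_map [FiniteDimensional ℂ H] (A B : H →ₗ[ℂ] H) (ψ : H ⊗[ℂ] H) :
    stateHomEquiv (TensorProduct.map A B ψ) = B ∘ₗ stateHomEquiv ψ ∘ₗ A.dualMap := by
  induction ψ with
  | zero => simp
  | add x y hx hy => simp [hx, hy, LinearMap.comp_add, LinearMap.add_comp]
  | tmul v w => ext ξ; simp

/-- A bipartite state is SLOCC-maximal iff it has full rank. -/
theorem sloccMaximal2_iff_bijective [FiniteDimensional ℂ H] (ψ : H ⊗[ℂ] H) :
    SLOCCMaximal2 ψ ↔ Function.Bijective (stateHomEquiv ψ) := by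
  constructor
  · intro h
    let e : Module.Dual ℂ H ≃ₗ[ℂ] H := LinearEquiv.ofFinrankEq _ _ Subspace.dual_finrank_eq
    obtain ⟨A, B, hAB⟩ := h (stateHomEquiv.symm e.toLinearMap)
      ⟨LinearMap.id, stateHomEquiv ψ ∘ₗ e.symm.toLinearMap, by
        apply stateHomEquiv.injective
        rw [stateHomEquiv_map, LinearEquiv.apply_symm_apply]
        ext ξ
        simp⟩
    have h' := congrArg stateHomEquiv hAB
    rw [LinearEquiv.apply_symm_apply, stateHomEquiv_map] at h'
    have hc : Function.Bijective (B ∘ stateHomEquiv ψ ∘ A.dualMap) := by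
      convert e.bijective using 1
      exact (congrArg (fun f : Module.Dual ℂ H →ₗ[ℂ] H => (f : Module.Dual ℂ H → H)) h').symm
    rwa [B.bijective.of_comp_iff', Function.Bijective.of_comp_iff _ A.dualMap.bijective] at hc
  · rintro h φ ⟨A, B, rfl⟩
    rw [stateHomEquiv_map] at h
    have hB : Function.Surjective B := Function.Surjective.of_comp h.surjective
    have hA : Function.Surjective A := by
      rw [← LinearMap.dualMap_injective_iff]
      exact Function.Injective.of_comp (f := B ∘ stateHomEquiv φ) h.injective
    have hA' := LinearMap.injective_iff_surjective.mpr hA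
    have hB' := LinearMap.injective_iff_surjective.mpr hB
    refine ⟨(LinearEquiv.ofBijective A ⟨hA', hA⟩).symm,
      (LinearEquiv.ofBijective B ⟨hB', hB⟩).symm, ?_⟩
    exact ((TensorProduct.congr (LinearEquiv.ofBijective A ⟨hA', hA⟩)
      (LinearEquiv.ofBijective B ⟨hB', hB⟩)).symm_apply_apply φ).symm

theorem lid_map_assoc_symm_tmul [FiniteDimensional ℂ H] (Φ : H ⊗[ℂ] H →ₗ[ℂ] ℂ) (u : H)
    (ψ : H ⊗[ℂ] H) :
    (TensorProduct.lid ℂ H)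
      ((TensorProduct.map Φ LinearMap.id)
        ((TensorProduct.assoc ℂ H H H).symm (u ⊗ₜ[ℂ] ψ))) =
      stateHomEquiv ψ (TensorProduct.curry Φ u) := by
  induction ψ with
  | zero => simp
  | add x y hx hy => simp only [TensorProduct.tmul_add, map_add, hx, hy, LinearMap.add_apply]
  | tmul v w => simp

/-- A bipartite state `ψ ∈ H ⊗ H` over a finite-dimensional complex
vector space is SLOCC-maximal iff there is a functional `Φ : H ⊗ H → ℂ` with
`(Φ ⊗ id)(u ⊗ ψ) = u` for all `u`, where `u ⊗ ψ` is read in `(H ⊗ H) ⊗ H` via the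
canonical associativity isomorphism. -/
theorem bipartite_maximal_iff [FiniteDimensional ℂ H] (ψ : H ⊗[ℂ] H) :
    SLOCCMaximal2 ψ ↔
      ∃ Φ : H ⊗[ℂ] H →ₗ[ℂ] ℂ, ∀ u : H,
        (TensorProduct.lid ℂ H)
          ((TensorProduct.map Φ LinearMap.id)
            ((TensorProduct.assoc ℂ H H H).symm (u ⊗ₜ[ℂ] ψ))) = u := by
  rw [sloccMaximal2_iff_bijective]
  simp only [lid_map_assoc_symm_tmul]
  constructor
  · intro h
    refine ⟨TensorProduct.lift (LinearEquiv.ofBijective _ h).symm.toLinearMap, fun u => ?_⟩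
    exact (LinearEquiv.ofBijective _ h).apply_symm_apply u
  · rintro ⟨Φ, hΦ⟩
    have hs : Function.Surjective (stateHomEquiv ψ) := fun u => ⟨_, hΦ u⟩
    exact ⟨(LinearMap.injective_iff_surjective_of_finrank_eq_finrank
      Subspace.dual_finrank_eq).mpr hs, hs⟩
end
end

section
/- Let H be a finite-dimensional complex vector space and ψ ∈ H ⊗ H ⊗ H a tripartite state. If ψ is strongly SLOCC-maximal, then ψ is SLOCC-maximal. -/
open TensorProduct

noncomputable section

variable {H : Type*} [AddCommGroup H] [Module ℂ H]

/-- SLOCC preorder for tripartite states: `φ ⪯ ψ`. -/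
def SLOCCLe3 (φ ψ : (H ⊗[ℂ] H) ⊗[ℂ] H) : Prop :=
  ∃ A B C : H →ₗ[ℂ] H, φ = TensorProduct.map (TensorProduct.map A B) C ψ

/-- SLOCC equivalence for tripartite states. -/
def SLOCCEquiv3 (φ ψ : (H ⊗[ℂ] H) ⊗[ℂ] H) : Prop :=
  ∃ A B C : H ≃ₗ[ℂ] H,
    φ = TensorProduct.map (TensorProduct.map A.toLinearMap B.toLinearMap) C.toLinearMap ψ

/-- A tripartite state `ψ` is SLOCC-maximal if every `φ` with `ψ ⪯ φ` satisfies `φ ∼ ψ`. -/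
def SLOCCMaximal3 (ψ : (H ⊗[ℂ] H) ⊗[ℂ] H) : Prop :=
  ∀ φ : (H ⊗[ℂ] H) ⊗[ℂ] H, SLOCCLe3 ψ φ → SLOCCEquiv3 φ ψ

/-- Every bipartite state is obtained from `∑ i, b i ⊗ b i` by a map on the first factor. -/
theorem exists_eq_map_sum_basis {ι : Type*} [Fintype ι] (b : Module.Basis ι ℂ H)
    (ψ : H ⊗[ℂ] H) :
    ∃ A : H →ₗ[ℂ] H, ψ = TensorProduct.map A LinearMap.id (∑ i, b i ⊗ₜ[ℂ] b i) := by
  induction ψ with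
  | zero => exact ⟨0, by simp⟩
  | add x y hx hy =>
    obtain ⟨A, hA⟩ := hx
    obtain ⟨B, hB⟩ := hy
    exact ⟨A + B, by rw [TensorProduct.map_add_left, LinearMap.add_apply, ← hA, ← hB]⟩
  | tmul x y =>
    refine ⟨(b.constr ℂ fun i => b.repr y i).smulRight x, ?_⟩
    simp only [map_sum, TensorProduct.map_tmul, LinearMap.smulRight_apply,
      Module.Basis.constr_basis, LinearMap.id_apply, TensorProduct.smul_tmul]
    rw [← TensorProduct.tmul_sum, b.sum_repr]

/-- A SLOCC-maximal bipartite state is equivalent to `∑ i, b i ⊗ b i`. -/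
theorem SLOCCMaximal2.equiv_sum_basis {ι : Type*} [Fintype ι] (b : Module.Basis ι ℂ H)
    {ψ : H ⊗[ℂ] H} (h : SLOCCMaximal2 ψ) : SLOCCEquiv2 (∑ i, b i ⊗ₜ[ℂ] b i) ψ := by
  obtain ⟨A, hA⟩ := exists_eq_map_sum_basis b ψ
  exact h _ ⟨A, LinearMap.id, hA⟩

/-- In finite dimension, an endomorphism that is right cancellable against functionals
is bijective. -/
theorem bijective_of_forall_dual_comp_eq_zero [FiniteDimensional ℂ H] {A : H →ₗ[ℂ] H}
    (h : ∀ α : H →ₗ[ℂ] ℂ, α ∘ₗ A = 0 → α = 0) : Function.Bijective A := by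
  have hs : Function.Surjective A := by
    rw [← LinearMap.range_eq_top]
    by_contra hne
    obtain ⟨α, hα, hle⟩ := Submodule.exists_le_ker_of_lt_top _ (lt_top_iff_ne_top.mpr hne)
    exact hα (h α (LinearMap.range_le_ker_iff.mp hle))
  exact ⟨LinearMap.injective_iff_surjective.mpr hs, hs⟩

theorem SLOCCMaximal2.bijective_left [FiniteDimensional ℂ H] {A B : H →ₗ[ℂ] H}
    {φ : H ⊗[ℂ] H} (h : SLOCCMaximal2 (TensorProduct.map A B φ)) : Function.Bijective A := by
  refine bijective_of_forall_dual_comp_eq_zero fun α hα => ?_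
  let b := Module.finBasis ℂ H
  obtain ⟨E, F, hEF⟩ := h.equiv_sum_basis b
  have key := congrArg (TensorProduct.lid ℂ H ∘
    TensorProduct.map (α ∘ₗ E.symm.toLinearMap) LinearMap.id) hEF
  have hE : (α ∘ₗ E.symm.toLinearMap) ∘ₗ E.toLinearMap ∘ₗ A = 0 := by
    rw [← hα]; ext x; simp
  simp only [Function.comp_apply, ← LinearMap.comp_apply, ← TensorProduct.map_comp, hE,
    TensorProduct.map_zero_left] at key
  simp only [LinearMap.zero_apply, map_zero, map_sum, TensorProduct.map_tmul,
    TensorProduct.lid_tmul, LinearMap.id_apply] at key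
  have h0 : α ∘ₗ E.symm.toLinearMap = 0 :=
    b.ext fun i => by simpa using Fintype.linearIndependent_iff.mp b.linearIndependent _ key i
  ext x
  simpa using LinearMap.congr_fun h0 (E x)

theorem SLOCCMaximal2.bijective_right [FiniteDimensional ℂ H] {A B : H →ₗ[ℂ] H}
    {φ : H ⊗[ℂ] H} (h : SLOCCMaximal2 (TensorProduct.map A B φ)) : Function.Bijective B := by
  refine bijective_of_forall_dual_comp_eq_zero fun α hα => ?_
  let b := Module.finBasis ℂ H
  obtain ⟨E, F, hEF⟩ := h.equiv_sum_basis b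
  have key := congrArg (TensorProduct.rid ℂ H ∘
    TensorProduct.map LinearMap.id (α ∘ₗ F.symm.toLinearMap)) hEF
  have hF : (α ∘ₗ F.symm.toLinearMap) ∘ₗ F.toLinearMap ∘ₗ B = 0 := by
    rw [← hα]; ext x; simp
  simp only [Function.comp_apply, ← LinearMap.comp_apply, ← TensorProduct.map_comp, hF,
    TensorProduct.map_zero_right] at key
  simp only [LinearMap.zero_apply, map_zero, map_sum, TensorProduct.map_tmul,
    TensorProduct.rid_tmul, LinearMap.id_apply] at key
  have h0 : α ∘ₗ F.symm.toLinearMap = 0 :=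
    b.ext fun i => by simpa using Fintype.linearIndependent_iff.mp b.linearIndependent _ key i
  ext x
  simpa using LinearMap.congr_fun h0 (F x)

theorem contr1_map (ξ : H →ₗ[ℂ] ℂ) (A B C : H →ₗ[ℂ] H) (φ : (H ⊗[ℂ] H) ⊗[ℂ] H) :
    contr1 ξ (TensorProduct.map (TensorProduct.map A B) C φ) =
      TensorProduct.map B C (contr1 (ξ ∘ₗ A) φ) := by
  simp only [← LinearMap.comp_apply]
  congr 1
  ext x y z
  simp [contr1]

theorem contr2_map (ξ : H →ₗ[ℂ] ℂ) (A B C : H →ₗ[ℂ] H) (φ : (H ⊗[ℂ] H) ⊗[ℂ] H) :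
    contr2 ξ (TensorProduct.map (TensorProduct.map A B) C φ) =
      TensorProduct.map A C (contr2 (ξ ∘ₗ B) φ) := by
  simp only [← LinearMap.comp_apply]
  congr 1
  ext x y z
  simp [contr2]

/-- A strongly SLOCC-maximal tripartite state over a finite-dimensional
complex vector space is SLOCC-maximal. -/
theorem strongly_maximal_implies_maximal [FiniteDimensional ℂ H]
    (ψ : (H ⊗[ℂ] H) ⊗[ℂ] H) (h : StronglySLOCCMaximal ψ) : SLOCCMaximal3 ψ := by
  obtain ⟨ξ₁, ξ₂, -, h₁, h₂, -⟩ := h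
  rintro φ ⟨A, B, C, rfl⟩
  rw [contr1_map] at h₁
  rw [contr2_map] at h₂
  let A' := LinearEquiv.ofBijective A h₂.bijective_left
  let B' := LinearEquiv.ofBijective B h₁.bijective_left
  let C' := LinearEquiv.ofBijective C h₁.bijective_right
  have h : TensorProduct.map (TensorProduct.map A B) C φ =
      TensorProduct.congr (TensorProduct.congr A' B') C' φ := rfl
  exact ⟨A'.symm, B'.symm, C'.symm,
    h ▸ ((TensorProduct.congr (TensorProduct.congr A' B') C').symm_apply_apply φ).symm⟩
end
end

section
/- Let (H, μ, η, δ, ε) be a commutative Frobenius algebra on a finite-dimensional complex vector space H, and let ψ := (δ ⊗ id_H)(δ(η 1)) ∈ H ⊗ H ⊗ H be its induced tripartite state. Then ψ is strongly SLOCC-maximal; in fact the counit ε witnesses this: the three bipartite states (ε⊗id⊗id)ψ, (id⊗ε⊗id)ψ, (id⊗id⊗ε)ψ in H ⊗ H are all SLOCC-maximal. -/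
open TensorProduct

noncomputable section

variable {H : Type*} [AddCommGroup H] [Module ℂ H]

/-- A commutative Frobenius algebra structure on `H`, given by multiplication `μ`,
unit `η`, comultiplication `δ` and counit `ε`: `μ` is associative and commutative with
unit `η 1`, `δ` is coassociative and cocommutative with counit `ε`, and the
Frobenius law `(μ ⊗ id)∘(id ⊗ δ) = δ∘μ = (id ⊗ μ)∘(δ ⊗ id)` holds. -/
structure IsCFA (μ : H ⊗[ℂ] H →ₗ[ℂ] H) (η : ℂ →ₗ[ℂ] H)
    (δ : H →ₗ[ℂ] H ⊗[ℂ] H) (ε : H →ₗ[ℂ] ℂ) : Prop where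
  assoc : ∀ x y z : H, μ (μ (x ⊗ₜ[ℂ] y) ⊗ₜ[ℂ] z) = μ (x ⊗ₜ[ℂ] μ (y ⊗ₜ[ℂ] z))
  comm : ∀ x y : H, μ (x ⊗ₜ[ℂ] y) = μ (y ⊗ₜ[ℂ] x)
  unit_left : ∀ x : H, μ (η 1 ⊗ₜ[ℂ] x) = x
  unit_right : ∀ x : H, μ (x ⊗ₜ[ℂ] η 1) = x
  coassoc : ∀ x : H,
    (TensorProduct.assoc ℂ H H H) ((TensorProduct.map δ LinearMap.id) (δ x)) =
      (TensorProduct.map LinearMap.id δ) (δ x)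
  cocomm : ∀ x : H, (TensorProduct.comm ℂ H H) (δ x) = δ x
  counit_left : ∀ x : H,
    (TensorProduct.lid ℂ H) ((TensorProduct.map ε LinearMap.id) (δ x)) = x
  counit_right : ∀ x : H,
    (TensorProduct.rid ℂ H) ((TensorProduct.map LinearMap.id ε) (δ x)) = x
  frob_left : ∀ x y : H,
    (TensorProduct.map μ LinearMap.id)
      ((TensorProduct.assoc ℂ H H H).symm ((TensorProduct.map LinearMap.id δ) (x ⊗ₜ[ℂ] y))) =
      δ (μ (x ⊗ₜ[ℂ] y))
  frob_right : ∀ x y : H,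
    (TensorProduct.map LinearMap.id μ)
      ((TensorProduct.assoc ℂ H H H) ((TensorProduct.map δ LinearMap.id) (x ⊗ₜ[ℂ] y))) =
      δ (μ (x ⊗ₜ[ℂ] y))
/-- The induced tripartite state `(δ ⊗ id)(δ(η 1))` of a CFA. -/
def cfaState (η : ℂ →ₗ[ℂ] H) (δ : H →ₗ[ℂ] H ⊗[ℂ] H) : (H ⊗[ℂ] H) ⊗[ℂ] H :=
  (TensorProduct.map δ LinearMap.id) (δ (η 1))
/-- Every vector is the right marginal of `ψ` for some functional on the left factor. -/
def LeftContractionSurjective (ψ : H ⊗[ℂ] H) : Prop :=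
  ∀ x : H, ∃ f : H →ₗ[ℂ] ℂ, TensorProduct.lid ℂ H (TensorProduct.map f LinearMap.id ψ) = x

lemma lid_map_map (f : H →ₗ[ℂ] ℂ) (A B : H →ₗ[ℂ] H) (φ : H ⊗[ℂ] H) :
    TensorProduct.lid ℂ H (TensorProduct.map f LinearMap.id (TensorProduct.map A B φ)) =
      B (TensorProduct.lid ℂ H (TensorProduct.map (f ∘ₗ A) LinearMap.id φ)) := by
  induction φ using TensorProduct.induction_on with
  | zero => simp
  | tmul a b => simp
  | add a b ha hb => simp only [map_add, ha, hb]

lemma LeftContractionSurjective.surjective_right {A B : H →ₗ[ℂ] H} {φ : H ⊗[ℂ] H}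
    (h : LeftContractionSurjective (TensorProduct.map A B φ)) : Function.Surjective B := by
  intro x
  obtain ⟨f, hf⟩ := h x
  exact ⟨_, (lid_map_map f A B φ).symm.trans hf⟩

/-- A symmetric bipartite state of full rank is SLOCC-maximal. -/
lemma LeftContractionSurjective.sloccMaximal2 [FiniteDimensional ℂ H] {ψ : H ⊗[ℂ] H}
    (h : LeftContractionSurjective ψ) (hsymm : TensorProduct.comm ℂ H H ψ = ψ) :
    SLOCCMaximal2 ψ := by
  rintro φ ⟨A, B, rfl⟩
  have hB : Function.Surjective B := h.surjective_right
  have hA : Function.Surjective A := by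
    rw [← hsymm, ← TensorProduct.map_comm] at h
    exact h.surjective_right
  let eA := LinearEquiv.ofBijective A ⟨LinearMap.injective_iff_surjective.mpr hA, hA⟩
  let eB := LinearEquiv.ofBijective B ⟨LinearMap.injective_iff_surjective.mpr hB, hB⟩
  refine ⟨eA.symm, eB.symm, ?_⟩
  exact ((TensorProduct.congr eA eB).symm_apply_apply φ).symm

lemma contr1_map_id (ξ : H →ₗ[ℂ] ℂ) (δ : H →ₗ[ℂ] H ⊗[ℂ] H)
    (h : ∀ x, TensorProduct.lid ℂ H (TensorProduct.map ξ LinearMap.id (δ x)) = x)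
    (t : H ⊗[ℂ] H) : contr1 ξ (TensorProduct.map δ LinearMap.id t) = t := by
  induction t using TensorProduct.induction_on with
  | zero => simp
  | tmul a b => simp [contr1, h]
  | add a b ha hb => simp only [map_add, ha, hb]

lemma contr2_map_id (ξ : H →ₗ[ℂ] ℂ) (δ : H →ₗ[ℂ] H ⊗[ℂ] H)
    (h : ∀ x, TensorProduct.rid ℂ H (TensorProduct.map LinearMap.id ξ (δ x)) = x)
    (t : H ⊗[ℂ] H) : contr2 ξ (TensorProduct.map δ LinearMap.id t) = t := by
  induction t using TensorProduct.induction_on with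
  | zero => simp
  | tmul a b => simp [contr2, h]
  | add a b ha hb => simp only [map_add, ha, hb]

lemma contr3_map_id (ξ : H →ₗ[ℂ] ℂ) (δ : H →ₗ[ℂ] H ⊗[ℂ] H) (t : H ⊗[ℂ] H) :
    contr3 ξ (TensorProduct.map δ LinearMap.id t) =
      δ (TensorProduct.rid ℂ H (TensorProduct.map LinearMap.id ξ t)) := by
  induction t using TensorProduct.induction_on with
  | zero => simp
  | tmul a b => simp [contr3]
  | add a b ha hb => simp only [map_add, ha, hb]

lemma map_mul_id_assoc_symm (μ : H ⊗[ℂ] H →ₗ[ℂ] H) (f : H →ₗ[ℂ] ℂ) (x : H) (t : H ⊗[ℂ] H) :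
    TensorProduct.map f LinearMap.id
        (TensorProduct.map μ LinearMap.id ((TensorProduct.assoc ℂ H H H).symm (x ⊗ₜ[ℂ] t))) =
      TensorProduct.map (f ∘ₗ μ ∘ₗ TensorProduct.mk ℂ H H x) LinearMap.id t := by
  induction t using TensorProduct.induction_on with
  | zero => simp
  | tmul a b => simp
  | add a b ha hb => simp only [TensorProduct.tmul_add, map_add, ha, hb]

lemma IsCFA.leftContractionSurjective {μ : H ⊗[ℂ] H →ₗ[ℂ] H} {η : ℂ →ₗ[ℂ] H}
    {δ : H →ₗ[ℂ] H ⊗[ℂ] H} {ε : H →ₗ[ℂ] ℂ} (hF : IsCFA μ η δ ε) :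
    LeftContractionSurjective (δ (η 1)) := by
  intro x
  refine ⟨ε ∘ₗ μ ∘ₗ TensorProduct.mk ℂ H H x, ?_⟩
  have hfrob := hF.frob_left x (η 1)
  rw [hF.unit_right, TensorProduct.map_tmul, LinearMap.id_apply] at hfrob
  rw [← map_mul_id_assoc_symm, hfrob, hF.counit_left]

/-- For a commutative Frobenius algebra on a finite-dimensional complex
vector space, the induced tripartite state `ψ := (δ ⊗ id)(δ (η 1))` is strongly
SLOCC-maximal; in fact the counit `ε` witnesses this: all three contractions
`(ε⊗id⊗id)ψ`, `(id⊗ε⊗id)ψ`, `(id⊗id⊗ε)ψ` are SLOCC-maximal bipartite states. -/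
theorem cfa_state_strongly_maximal [FiniteDimensional ℂ H]
    (μ : H ⊗[ℂ] H →ₗ[ℂ] H) (η : ℂ →ₗ[ℂ] H) (δ : H →ₗ[ℂ] H ⊗[ℂ] H) (ε : H →ₗ[ℂ] ℂ)
    (hF : IsCFA μ η δ ε) :
    (SLOCCMaximal2 (contr1 ε (cfaState η δ)) ∧
     SLOCCMaximal2 (contr2 ε (cfaState η δ)) ∧
     SLOCCMaximal2 (contr3 ε (cfaState η δ))) ∧
    StronglySLOCCMaximal (cfaState η δ) := by
  have hmax : SLOCCMaximal2 (δ (η 1)) :=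
    hF.leftContractionSurjective.sloccMaximal2 (hF.cocomm _)
  have hall : SLOCCMaximal2 (contr1 ε (cfaState η δ)) ∧
      SLOCCMaximal2 (contr2 ε (cfaState η δ)) ∧ SLOCCMaximal2 (contr3 ε (cfaState η δ)) := by
    simp only [cfaState]
    rw [contr1_map_id ε δ hF.counit_left, contr2_map_id ε δ hF.counit_right, contr3_map_id,
      hF.counit_right]
    exact ⟨hmax, hmax, hmax⟩
  exact ⟨hall, ε, ε, ε, hall⟩
end
end

section
/- (Mathonet et al.) Let N ≥ 3 and let ψ, φ be states in the N-fold tensor power of ℂ² over ℂ, each invariant under every permutation of the N tensor factors. If there exist bijective ℂ-linear maps L₁, …, L_N : ℂ² → ℂ² with ψ = (L₁ ⊗ ⋯ ⊗ L_N)φ, then there exists a single bijective ℂ-linear map L : ℂ² → ℂ² with ψ = (L ⊗ ⋯ ⊗ L)φ (L applied to every tensor factor). -/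
open TensorProduct

noncomputable section

/-- A state in the `N`-fold tensor power of `ℂ²` is symmetric if it is fixed by the
linear automorphism induced by every permutation of the tensor factors. -/
def SymmetricState (N : ℕ) (ψ : ⨂[ℂ] (_ : Fin N), (Fin 2 → ℂ)) : Prop :=
  ∀ σ : Equiv.Perm (Fin N),
    (PiTensorProduct.reindex ℂ (fun _ => Fin 2 → ℂ) σ) ψ = ψ

section SlotOperators

variable {K V ι : Type*} [Field K] [AddCommGroup V] [Module K V] [DecidableEq ι]

lemma map_mulSingle_smul (k : ι) (r : K) (A : Module.End K V) :
    PiTensorProduct.map (Pi.mulSingle k (r • A) : ι → Module.End K V) =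
      r • PiTensorProduct.map (Pi.mulSingle k A : ι → Module.End K V) :=
  PiTensorProduct.map_update_smul (s := fun _ => V) (t := fun _ => V) (f := fun _ => 1) k r A

lemma map_mulSingle_add (k : ι) (A B : Module.End K V) :
    PiTensorProduct.map (Pi.mulSingle k (A + B) : ι → Module.End K V) =
      PiTensorProduct.map (Pi.mulSingle k A : ι → Module.End K V) +
        PiTensorProduct.map (Pi.mulSingle k B : ι → Module.End K V) :=
  PiTensorProduct.map_update_add (s := fun _ => V) (t := fun _ => V) (f := fun _ => 1) k A B

lemma map_mulSingle_zero (k : ι) :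
    PiTensorProduct.map (Pi.mulSingle k 0 : ι → Module.End K V) = 0 := by
  simpa using map_mulSingle_smul k (0 : K) (0 : Module.End K V)

/-- The algebra homomorphism sending an endomorphism `M` to the endomorphism of the tensor power
that applies `M` in the tensor factor `k` and the identity in all others. -/
def slotMap (k : ι) : Module.End K V →ₐ[K] Module.End K (⨂[K] (_ : ι), V) where
  toFun M := PiTensorProduct.mapMonoidHom (Pi.mulSingle k M)
  map_one' := by rw [Pi.mulSingle_one, map_one]
  map_mul' A B := by rw [Pi.mulSingle_mul, map_mul]
  map_zero' := map_mulSingle_zero k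
  map_add' A B := map_mulSingle_add k A B
  commutes' r := by
    rw [Algebra.algebraMap_eq_smul_one, Algebra.algebraMap_eq_smul_one]
    refine (map_mulSingle_smul k r 1).trans ?_
    rw [Pi.mulSingle_one]
    exact congrArg (r • ·) PiTensorProduct.map_one

lemma slotMap_apply (k : ι) (M : Module.End K V) :
    slotMap k M = PiTensorProduct.mapMonoidHom (Pi.mulSingle k M) := rfl

lemma slotMap_commute {k l : ι} (h : k ≠ l) (A B : Module.End K V) :
    Commute (slotMap k A) (slotMap l B) := by
  rw [slotMap_apply, slotMap_apply]
  exact (Pi.mulSingle_commute (f := fun _ => Module.End K V) h A B).map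
    PiTensorProduct.mapMonoidHom

/-- Endomorphisms whose action on `φ` does not depend on the tensor factor they are applied in. -/
def IsSlotIndependent (φ : ⨂[K] (_ : ι), V) (M : Module.End K V) : Prop :=
  ∀ k l, slotMap k M φ = slotMap l M φ

variable [Fintype ι]

lemma exists_ne_ne_of_two_lt_card (hι : 2 < Fintype.card ι) (k l : ι) : ∃ m, m ≠ k ∧ m ≠ l := by
  obtain ⟨m, -, hm⟩ := Finset.exists_mem_notMem_of_card_lt_card
    (s := {k, l}) (t := Finset.univ) (Finset.card_le_two.trans_lt hι)
  exact ⟨m, by simpa using hm⟩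

lemma IsSlotIndependent.mul (hι : 2 < Fintype.card ι) {φ : ⨂[K] (_ : ι), V}
    {A B : Module.End K V} (hA : IsSlotIndependent φ A) (hB : IsSlotIndependent φ B) :
    IsSlotIndependent φ (A * B) := by
  intro k l
  obtain rfl | hkl := eq_or_ne k l
  · rfl
  obtain ⟨m, hmk, hml⟩ := exists_ne_ne_of_two_lt_card hι k l
  calc slotMap k (A * B) φ = slotMap k A (slotMap k B φ) := by rw [map_mul]; rfl
    _ = slotMap k A (slotMap m B φ) := by rw [hB k m]
    _ = slotMap m B (slotMap k A φ) := LinearMap.congr_fun (slotMap_commute hmk.symm A B).eq φ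
    _ = slotMap m B (slotMap l A φ) := by rw [hA k l]
    _ = slotMap l A (slotMap m B φ) := LinearMap.congr_fun (slotMap_commute hml B A).eq φ
    _ = slotMap l A (slotMap l B φ) := by rw [hB m l]
    _ = slotMap l (A * B) φ := by rw [map_mul]; rfl

/-- The slot-independent endomorphisms form a subalgebra when there are at least three factors. -/
def slotIndependentSubalgebra (hι : 2 < Fintype.card ι) (φ : ⨂[K] (_ : ι), V) :
    Subalgebra K (Module.End K V) where
  carrier := {M | IsSlotIndependent φ M}
  mul_mem' := IsSlotIndependent.mul hι
  add_mem' hA hB k l := by simp [hA k l, hB k l]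
  algebraMap_mem' r k l := by simp only [AlgHom.commutes]

lemma slotMap_apply_slotMap_apply (hι : 2 < Fintype.card ι) {φ : ⨂[K] (_ : ι), V}
    {A B : Module.End K V} (hA : IsSlotIndependent φ A) (hB : IsSlotIndependent φ B) (i k : ι) :
    slotMap i B (slotMap k A φ) = slotMap k (A * B) φ := by
  obtain ⟨m, hmi, -⟩ := exists_ne_ne_of_two_lt_card hι i i
  calc slotMap i B (slotMap k A φ) = slotMap i B (slotMap m A φ) := by rw [hA k m]
    _ = slotMap m A (slotMap i B φ) := LinearMap.congr_fun (slotMap_commute hmi.symm B A).eq φ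
    _ = slotMap m A (slotMap m B φ) := by rw [hB i m]
    _ = slotMap m (A * B) φ := by rw [map_mul]; rfl
    _ = slotMap k (A * B) φ := hA.mul hι hB m k

lemma map_piecewise_apply (hι : 2 < Fintype.card ι) {φ : ⨂[K] (_ : ι), V}
    {F : ι → Module.End K V} (hF : ∀ i, IsSlotIndependent φ (F i)) (k : ι) (l : List ι)
    (hl : l.Nodup) :
    PiTensorProduct.map (fun i => if i ∈ l then F i else 1) φ =
      slotMap k (l.reverse.map F).prod φ := by
  induction l with
  | nil => simp [PiTensorProduct.map_one]
  | cons a l ih =>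
    obtain ⟨ha, hl⟩ := List.nodup_cons.mp hl
    have hsplit : (fun i => if i ∈ a :: l then F i else 1) =
        fun i => (Pi.mulSingle a (F a) : ι → Module.End K V) i * (if i ∈ l then F i else 1) := by
      funext i
      obtain rfl | hia := eq_or_ne i a
      · simp [ha]
      · simp [hia]
    have hprod : IsSlotIndependent φ (l.reverse.map F).prod :=
      list_prod_mem (S := slotIndependentSubalgebra hι φ) (by
        intro M hM
        obtain ⟨i, -, rfl⟩ := List.mem_map.mp hM
        exact hF i)
    rw [hsplit, PiTensorProduct.map_mul, Module.End.mul_apply, ih hl]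
    refine (slotMap_apply_slotMap_apply hι hprod (hF a) a k).trans ?_
    simp

/-- Slot-independent operators acting on all factors can be collected in a single factor. -/
lemma map_apply_eq_slotMap_prod (hι : 2 < Fintype.card ι) {φ : ⨂[K] (_ : ι), V}
    {F : ι → Module.End K V} (hF : ∀ i, IsSlotIndependent φ (F i)) (k : ι) :
    PiTensorProduct.map F φ =
      slotMap k ((Finset.univ : Finset ι).toList.reverse.map F).prod φ := by
  simpa using map_piecewise_apply hι hF k Finset.univ.toList (Finset.nodup_toList _)

end SlotOperators

section Roots

open Polynomial

/-- An invertible endomorphism of a plane over an algebraically closed field of characteristic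
zero has an `n`-th root which is a polynomial in it. -/
lemma exists_aeval_pow_eq {K V : Type*} [Field K] [IsAlgClosed K] [CharZero K] [AddCommGroup V]
    [Module K V] (hV : Module.finrank K V = 2) {A : Module.End K V} (hA : IsUnit A) {n : ℕ}
    (hn : n ≠ 0) : ∃ p : K[X], (aeval A p) ^ n = A := by
  have : FiniteDimensional K V := Module.finite_of_finrank_eq_succ hV
  have hsplits := IsAlgClosed.splits A.charpoly
  have hcard : A.charpoly.roots.card = 2 := by
    rw [← hsplits.natDegree_eq_card_roots, A.charpoly_natDegree, hV]
  obtain ⟨a, b, hab⟩ := Multiset.card_eq_two.mp hcard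
  have hchar : A.charpoly = (X - C a) * (X - C b) := by
    rw [hsplits.eq_prod_roots_of_monic A.charpoly_monic, hab]
    simp
  have hne : ∀ c ∈ A.charpoly.roots, c ≠ 0 := by
    rintro c hc rfl
    have h0 := (Module.End.hasEigenvalue_iff_isRoot_charpoly A 0).mpr (isRoot_of_mem_roots hc)
    obtain ⟨v, hv⟩ := h0.exists_hasEigenvector
    refine hv.2 (((Module.End.isUnit_iff A).mp hA).1 ?_)
    simpa using hv.apply_eq_smul
  have ha : a ≠ 0 := hne a (by simp [hab])
  obtain ⟨x, hx⟩ := IsAlgClosed.exists_pow_nat_eq a (Nat.pos_of_ne_zero hn)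
  obtain ⟨y, hy⟩ := IsAlgClosed.exists_pow_nat_eq b (Nat.pos_of_ne_zero hn)
  suffices h : ∃ p : K[X], (X - C a) * (X - C b) ∣ p ^ n - X by
    obtain ⟨p, q, hq⟩ := h
    refine ⟨p, sub_eq_zero.mp ?_⟩
    have := congrArg (aeval A) hq
    rw [← hchar, map_mul, A.aeval_self_charpoly, zero_mul] at this
    simpa using this
  obtain rfl | hne_ab := eq_or_ne a b
  · have hx0 : x ≠ 0 := by
      rintro rfl
      exact ha (by rw [← hx, zero_pow hn])
    have hn0 : (n : K) ≠ 0 := Nat.cast_ne_zero.mpr hn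
    have hslope : (n : K) * x ^ (n - 1) * (x / (n * a)) = 1 := by
      have : x ^ (n - 1) * x = a := by rw [pow_sub_one_mul hn, hx]
      field_simp
      exact this
    refine ⟨C x + C (x / (n * a)) * (X - C a), ?_⟩
    obtain ⟨r, hr⟩ := Polynomial.powAddExpansion (C x) (C (x / (n * a)) * (X - C a)) n
    refine ⟨r * C (x / (n * a)) ^ 2, ?_⟩
    have hslope' : (n : K[X]) * C x ^ (n - 1) * C (x / (n * a)) = 1 := by
      simpa only [C_mul, C_pow, map_natCast, map_one] using congrArg C hslope
    rw [hr, ← C_pow, hx]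
    linear_combination (X - C a) * hslope'
  · have hsub : a - b ≠ 0 := sub_ne_zero.mpr hne_ab
    refine ⟨C x + C ((x - y) / (a - b)) * (X - C a), ?_⟩
    refine IsCoprime.mul_dvd (isCoprime_X_sub_C_of_isUnit_sub hsub.isUnit) ?_ ?_
    · simp [dvd_iff_isRoot, hx]
    · have : x + (x - y) / (a - b) * (b - a) = y := by field_simp; ring
      simp [dvd_iff_isRoot, this, hy]

end Roots

lemma exists_perm_apply_eq_apply_eq {ι : Type*} [DecidableEq ι] {i j k l : ι} (hij : i ≠ j)
    (hkl : k ≠ l) : ∃ σ : Equiv.Perm ι, σ i = k ∧ σ j = l := by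
  refine ⟨Equiv.swap (Equiv.swap i k j) l * Equiv.swap i k, ?_, by simp⟩
  have : k ≠ Equiv.swap i k j := by
    intro h
    exact hij ((Equiv.swap i k).injective (by rw [Equiv.swap_apply_left, ← h]))
  simp [Equiv.swap_apply_of_ne_of_ne this hkl]

lemma SymmetricState.map_comp {N : ℕ} {φ : ⨂[ℂ] (_ : Fin N), (Fin 2 → ℂ)}
    (hφ : SymmetricState N φ) (F : Fin N → Module.End ℂ (Fin 2 → ℂ)) (σ : Equiv.Perm (Fin N)) :
    PiTensorProduct.map (fun i => F (σ.symm i)) φ =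
      PiTensorProduct.reindex ℂ (fun _ => Fin 2 → ℂ) σ (PiTensorProduct.map F φ) := by
  conv_lhs => rw [← hφ σ]
  exact PiTensorProduct.map_reindex F σ φ

lemma SymmetricState.isSlotIndependent {N : ℕ} {φ : ⨂[ℂ] (_ : Fin N), (Fin 2 → ℂ)}
    (hφ : SymmetricState N φ) {M : Module.End ℂ (Fin 2 → ℂ)} {i j : Fin N} (hij : i ≠ j)
    (h : slotMap i M φ = slotMap j M φ) : IsSlotIndependent φ M := by
  have hmove (σ : Equiv.Perm (Fin N)) (a : Fin N) : slotMap (σ a) M φ =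
      PiTensorProduct.reindex ℂ (fun _ => Fin 2 → ℂ) σ (slotMap a M φ) := by
    refine Eq.trans ?_ (hφ.map_comp (Pi.mulSingle a M) σ)
    rw [slotMap_apply, PiTensorProduct.mapMonoidHom_apply]
    congr 2
    funext b
    simp [Pi.mulSingle_apply, Equiv.symm_apply_eq]
  intro k l
  obtain rfl | hkl := eq_or_ne k l
  · rfl
  obtain ⟨σ, rfl, rfl⟩ := exists_perm_apply_eq_apply_eq hij hkl
  rw [hmove, hmove, h]

/-- Symmetry of both states makes the relative local operators slot-independent. -/
lemma SymmetricState.isSlotIndependent_symm_mul {N : ℕ} {ψ φ : ⨂[ℂ] (_ : Fin N), (Fin 2 → ℂ)}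
    (hψ : SymmetricState N ψ) (hφ : SymmetricState N φ)
    (L : Fin N → ((Fin 2 → ℂ) ≃ₗ[ℂ] (Fin 2 → ℂ)))
    (h : ψ = PiTensorProduct.map (fun i => (L i).toLinearMap) φ) (i j : Fin N) :
    IsSlotIndependent φ ((L i).symm.toLinearMap * (L j).toLinearMap : Module.End ℂ _) := by
  obtain rfl | hij := eq_or_ne i j
  · have : ((L i).symm.toLinearMap * (L i).toLinearMap : Module.End ℂ _) = 1 := by
      ext; simp
    intro k l
    rw [this, map_one, map_one]
  refine hφ.isSlotIndependent hij ?_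
  have hswap : PiTensorProduct.map (fun k => (L (Equiv.swap i j k)).toLinearMap) φ =
      PiTensorProduct.map (fun k => (L k).toLinearMap) φ := by
    have := hφ.map_comp (fun k => (L k).toLinearMap) (Equiv.swap i j)
    rw [← h, hψ, h] at this
    simpa using this
  have key := congrArg (PiTensorProduct.map
    (fun k => (L (if k = j then i else k)).symm.toLinearMap)) hswap
  rw [← LinearMap.comp_apply, ← LinearMap.comp_apply, ← PiTensorProduct.map_comp,
    ← PiTensorProduct.map_comp] at key
  have hcancel (k : Fin N) : (L k).symm.toLinearMap ∘ₗ (L k).toLinearMap = 1 := by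
    ext; simp
  convert key using 3
  · rw [slotMap_apply, PiTensorProduct.mapMonoidHom_apply]
    congr 1
    funext k
    obtain rfl | hki := eq_or_ne k i
    · simp [hij]; rfl
    obtain rfl | hkj := eq_or_ne k j
    · simp [hki, hcancel]
    · simp [hki, hkj, Equiv.swap_apply_of_ne_of_ne hki hkj, hcancel]
  · rw [slotMap_apply, PiTensorProduct.mapMonoidHom_apply]
    congr 1
    funext k
    obtain rfl | hkj := eq_or_ne k j
    · simp; rfl
    · simp [hkj, hcancel]

/-- Mathonet et al.. If two symmetric `N`-qubit states (`N ≥ 3`) are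
related by a tensor product of bijective linear maps `L₁ ⊗ ⋯ ⊗ L_N`, then they are
related by `L ⊗ ⋯ ⊗ L` for a single bijective linear map `L`. -/
theorem symmetric_slocc_uniform (N : ℕ) (hN : 3 ≤ N)
    (ψ φ : ⨂[ℂ] (_ : Fin N), (Fin 2 → ℂ))
    (hψ : SymmetricState N ψ) (hφ : SymmetricState N φ)
    (L : Fin N → ((Fin 2 → ℂ) ≃ₗ[ℂ] (Fin 2 → ℂ)))
    (h : ψ = PiTensorProduct.map (fun i => (L i).toLinearMap) φ) :
    ∃ L₀ : (Fin 2 → ℂ) ≃ₗ[ℂ] (Fin 2 → ℂ),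
      ψ = PiTensorProduct.map (fun _ => L₀.toLinearMap) φ := by
  have hcard : 2 < Fintype.card (Fin N) := by
    rw [Fintype.card_fin]
    exact hN
  have hN0 : N ≠ 0 := by lia
  let o : Fin N := ⟨0, by lia⟩
  let F : Fin N → Module.End ℂ (Fin 2 → ℂ) :=
    fun i => (L o).symm.toLinearMap * (L i).toLinearMap
  have hF (i : Fin N) : IsSlotIndependent φ (F i) := hψ.isSlotIndependent_symm_mul hφ L h o i
  have hFunit (i : Fin N) : IsUnit (F i) :=
    (Module.End.isUnit_iff _).mpr ((L i).trans (L o).symm).bijective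
  let A : Module.End ℂ (Fin 2 → ℂ) := ((Finset.univ : Finset (Fin N)).toList.reverse.map F).prod
  have hAunit : IsUnit A := list_prod_mem (S := IsUnit.submonoid _) (by
    intro M hM
    obtain ⟨i, -, rfl⟩ := List.mem_map.mp hM
    exact hFunit i)
  have hA : A ∈ slotIndependentSubalgebra hcard φ := list_prod_mem (by
    intro M hM
    obtain ⟨i, -, rfl⟩ := List.mem_map.mp hM
    exact hF i)
  obtain ⟨p, hp⟩ := exists_aeval_pow_eq (by simp) hAunit hN0
  set R := Polynomial.aeval A p
  have hR : IsSlotIndependent φ R :=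
    Algebra.adjoin_le (Set.singleton_subset_iff.mpr hA) (Polynomial.aeval_mem_adjoin_singleton ℂ A)
  have hRunit : IsUnit R := (isUnit_pow_iff hN0).mp (hp ▸ hAunit)
  let R' := LinearEquiv.ofBijective R ((Module.End.isUnit_iff R).mp hRunit)
  refine ⟨R'.trans (L o), ?_⟩
  have hFR : PiTensorProduct.map F φ = PiTensorProduct.map (fun _ => R) φ := by
    rw [map_apply_eq_slotMap_prod hcard hF o,
      map_apply_eq_slotMap_prod hcard (F := fun _ => R) (fun _ => hR) o]
    simp [hp, A]
  calc ψ = PiTensorProduct.map (fun i => (L o).toLinearMap ∘ₗ F i) φ := by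
        rw [h]
        congr 2
        funext i
        ext : 2
        simp [F]
    _ = PiTensorProduct.map (fun _ => (L o).toLinearMap) (PiTensorProduct.map F φ) := by
        rw [PiTensorProduct.map_comp]; rfl
    _ = PiTensorProduct.map (fun _ => (L o).toLinearMap ∘ₗ R) φ := by
        rw [hFR, PiTensorProduct.map_comp]; rfl
end
end

section
/- Let (ℂ², μ, η, δ, ε) be a special commutative Frobenius algebra on ℂ², and let ψ := (δ ⊗ id)(δ(η 1)) ∈ ℂ² ⊗ ℂ² ⊗ ℂ² be its induced tripartite state. Then ψ is SLOCC-equivalent to the GHZ state: there exist bijective ℂ-linear maps L₁, L₂, L₃ : ℂ² → ℂ² such that ψ = (L₁ ⊗ L₂ ⊗ L₃)|GHZ⟩. -/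
open TensorProduct

noncomputable section

variable {H : Type*} [AddCommGroup H] [Module ℂ H]

/-- The first standard basis vector of `ℂ²`. -/
def e₀ : Fin 2 → ℂ := Pi.single 0 1

/-- The second standard basis vector of `ℂ²`. -/
def e₁ : Fin 2 → ℂ := Pi.single 1 1
/-- The GHZ state `e₀⊗e₀⊗e₀ + e₁⊗e₁⊗e₁`. -/
def GHZ : ((Fin 2 → ℂ) ⊗[ℂ] (Fin 2 → ℂ)) ⊗[ℂ] (Fin 2 → ℂ) :=
  (e₀ ⊗ₜ[ℂ] e₀) ⊗ₜ[ℂ] e₀ + (e₁ ⊗ₜ[ℂ] e₁) ⊗ₜ[ℂ] e₁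

namespace IsCFA

variable {μ : H ⊗[ℂ] H →ₗ[ℂ] H} {η : ℂ →ₗ[ℂ] H} {δ : H →ₗ[ℂ] H ⊗[ℂ] H} {ε : H →ₗ[ℂ] ℂ}

/-- Comultiplication is linear over multiplication on the left tensor factor. -/
theorem comul_mul (hF : IsCFA μ η δ ε) (x y : H) :
    δ (μ (x ⊗ₜ[ℂ] y)) =
      TensorProduct.map (μ ∘ₗ TensorProduct.mk ℂ H H x) LinearMap.id (δ y) := by
  rw [← hF.frob_left, TensorProduct.map_tmul]
  induction δ y using TensorProduct.induction_on with
  | zero => simp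
  | tmul a b => simp
  | add a b ha hb => simp only [map_add, TensorProduct.tmul_add, ha, hb]

/-- A nonzero element `f` spanning an ideal of a special CFA satisfies `f² = ε(f) f`,
`ε(f) ≠ 0`, and its comultiple is proportional to `f ⊗ f`. -/
theorem comul_of_mul_mem_span (hF : IsCFA μ η δ ε) (hS : μ ∘ₗ δ = LinearMap.id)
    {f : H} (hf : f ≠ 0) (hspan : ∀ w, ∃ c : ℂ, μ (f ⊗ₜ[ℂ] w) = c • f) :
    ε f ≠ 0 ∧ μ (f ⊗ₜ[ℂ] f) = ε f • f ∧ ε f • δ f = f ⊗ₜ[ℂ] f := by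
  have hfac : ∃ p : H, δ f = f ⊗ₜ[ℂ] p := by
    have h := hF.comul_mul f (η 1)
    rw [hF.unit_right] at h
    rw [h]
    induction δ (η 1) using TensorProduct.induction_on with
    | zero => exact ⟨0, by simp⟩
    | tmul a b =>
      obtain ⟨c, hc⟩ := hspan a
      exact ⟨c • b, by simp [hc, TensorProduct.smul_tmul]⟩
    | add a b ha hb =>
      obtain ⟨p, hp⟩ := ha
      obtain ⟨q, hq⟩ := hb
      exact ⟨p + q, by rw [map_add, hp, hq, TensorProduct.tmul_add]⟩
  obtain ⟨p, hp⟩ := hfac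
  have hεp : ε f • p = f := by simpa [hp] using hF.counit_left f
  have hfp : μ (f ⊗ₜ[ℂ] p) = f := by simpa [hp] using LinearMap.congr_fun hS f
  refine ⟨fun h => hf (by rw [← hεp, h, zero_smul]), ?_, ?_⟩
  · conv_lhs => rw [← hεp, TensorProduct.tmul_smul, map_smul, hεp, hfp]
  · rw [hp, ← TensorProduct.tmul_smul, hεp]

end IsCFA

/-- A special CFA of dimension two has a basis of group-like elements with sum the unit. -/
theorem IsCFA.exists_grouplike_basis
    {μ : H ⊗[ℂ] H →ₗ[ℂ] H} {η : ℂ →ₗ[ℂ] H} {δ : H →ₗ[ℂ] H ⊗[ℂ] H} {ε : H →ₗ[ℂ] ℂ}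
    (hF : IsCFA μ η δ ε) (hS : μ ∘ₗ δ = LinearMap.id) (hH : Module.finrank ℂ H = 2) :
    ∃ b : Module.Basis (Fin 2) ℂ H, (∀ i, δ (b i) = b i ⊗ₜ[ℂ] b i) ∧ η 1 = b 0 + b 1 := by
  have : Nontrivial H := Module.nontrivial_of_finrank_pos (R := ℂ) (by omega)
  set u := η 1 with hu
  have hu0 : u ≠ 0 := by
    intro h
    obtain ⟨x, hx⟩ := exists_ne (0 : H)
    exact hx (by rw [← hF.unit_left x, ← hu, h, TensorProduct.zero_tmul, map_zero])
  obtain ⟨a, ha⟩ := exists_linearIndependent_pair_of_one_lt_finrank (R := ℂ)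
    (by omega : 1 < Module.finrank ℂ H) hu0
  have hgen : ∀ w : H, ∃ c d : ℂ, w = c • u + d • a := fun w => by
    let B := basisOfLinearIndependentOfCardEqFinrank ha (by simp [hH])
    refine ⟨B.repr w 0, B.repr w 1, ?_⟩
    simpa [B, Fin.sum_univ_two] using (B.sum_repr w).symm
  rw [LinearIndependent.pair_iff] at ha
  obtain ⟨q, t, haa⟩ := hgen (μ (a ⊗ₜ[ℂ] a))
  obtain ⟨z, hz⟩ := IsAlgClosed.exists_pow_nat_eq (t ^ 2 + 4 * q) (n := 2) (by norm_num)
  obtain ⟨r, s, rfl, rfl⟩ : ∃ r s : ℂ, t = r + s ∧ q = -(r * s) :=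
    ⟨(t + z) / 2, (t - z) / 2, by ring, by linear_combination (-1 / 4 : ℂ) * hz⟩
  have hne : ∀ k : ℂ, a - k • u ≠ 0 := fun k h => by
    have := (ha (-k) 1 (by rw [← h]; module)).2
    exact one_ne_zero this
  have hmul : ∀ k c d : ℂ, μ ((a - k • u) ⊗ₜ[ℂ] (c • u + d • a)) =
      c • a + d • (-(r * s) • u + (r + s) • a) - (k * c) • u - (k * d) • a := fun k c d => by
    simp only [TensorProduct.sub_tmul, TensorProduct.tmul_add, TensorProduct.tmul_smul,
      ← TensorProduct.smul_tmul', map_sub, map_add, map_smul, haa, hF.unit_left, hF.unit_right,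
      hu]
    module
  obtain ⟨hr0, hr1, hr2⟩ := hF.comul_of_mul_mem_span hS (hne r) fun w => by
    obtain ⟨c, d, rfl⟩ := hgen w
    exact ⟨c + d * s, by rw [hmul]; module⟩
  obtain ⟨hs0, hs1, hs2⟩ := hF.comul_of_mul_mem_span hS (hne s) fun w => by
    obtain ⟨c, d, rfl⟩ := hgen w
    exact ⟨c + d * r, by rw [hmul]; module⟩
  have hεr : ε (a - r • u) = s - r := by
    have h := hmul r (-r) 1
    rw [show (-r) • u + (1 : ℂ) • a = a - r • u by module, hr1] at h
    refine sub_eq_zero.mp ((smul_eq_zero.mp ?_).resolve_right (hne r))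
    rw [sub_smul, h]
    module
  have hεs : ε (a - s • u) = r - s := by
    have h := hmul s (-s) 1
    rw [show (-s) • u + (1 : ℂ) • a = a - s • u by module, hs1] at h
    refine sub_eq_zero.mp ((smul_eq_zero.mp ?_).resolve_right (hne s))
    rw [sub_smul, h]
    module
  rw [hεr] at hr0 hr2
  rw [hεs] at hs0 hs2
  have hli : LinearIndependent ℂ ![(r - s)⁻¹ • (a - s • u), (s - r)⁻¹ • (a - r • u)] := by
    rw [LinearIndependent.pair_iff]
    intro c d h
    obtain ⟨h1, h2⟩ := ha (-(c * (r - s)⁻¹ * s) - d * (s - r)⁻¹ * r)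
      (c * (r - s)⁻¹ + d * (s - r)⁻¹) (by rw [← h]; module)
    have hinv : (s - r)⁻¹ = -(r - s)⁻¹ := by rw [← neg_sub, inv_neg]
    rw [hinv] at h1 h2
    have hi : (r - s) * (r - s)⁻¹ = 1 := mul_inv_cancel₀ hs0
    constructor
    · linear_combination h1 + r * h2 - c * hi
    · linear_combination h1 + s * h2 - d * hi
  refine ⟨basisOfLinearIndependentOfCardEqFinrank hli (by simp [hH]), ?_, ?_⟩
  · have hgl : ∀ (k : ℂ) (f : H), k ≠ 0 → k • δ f = f ⊗ₜ[ℂ] f →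
        δ (k⁻¹ • f) = (k⁻¹ • f) ⊗ₜ[ℂ] (k⁻¹ • f) := fun k f hk h => by
      rw [TensorProduct.smul_tmul_smul, ← h, smul_smul, map_smul, mul_assoc,
        inv_mul_cancel₀ hk, mul_one]
    intro i
    fin_cases i
    · simpa using hgl _ _ hs0 hs2
    · simpa using hgl _ _ hr0 hr2
  · have hinv : (s - r)⁻¹ = -(r - s)⁻¹ := by rw [← neg_sub, inv_neg]
    simp only [coe_basisOfLinearIndependentOfCardEqFinrank, Matrix.cons_val_zero,
      Matrix.cons_val_one, hinv]
    calc u = ((r - s)⁻¹ * (r - s)) • u := by rw [inv_mul_cancel₀ hs0, one_smul]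
      _ = _ := by module

/-- The induced tripartite state of a special commutative Frobenius
algebra on `ℂ²` is SLOCC-equivalent to the GHZ state. -/
theorem scfa_state_slocc_ghz
    (μ : (Fin 2 → ℂ) ⊗[ℂ] (Fin 2 → ℂ) →ₗ[ℂ] (Fin 2 → ℂ)) (η : ℂ →ₗ[ℂ] (Fin 2 → ℂ))
    (δ : (Fin 2 → ℂ) →ₗ[ℂ] (Fin 2 → ℂ) ⊗[ℂ] (Fin 2 → ℂ)) (ε : (Fin 2 → ℂ) →ₗ[ℂ] ℂ)
    (hF : IsCFA μ η δ ε) (hS : μ ∘ₗ δ = LinearMap.id) :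
    ∃ L₁ L₂ L₃ : (Fin 2 → ℂ) ≃ₗ[ℂ] (Fin 2 → ℂ),
      cfaState η δ =
        TensorProduct.map (TensorProduct.map L₁.toLinearMap L₂.toLinearMap)
          L₃.toLinearMap GHZ := by
  obtain ⟨b, hb, hu⟩ := hF.exists_grouplike_basis hS (by simp)
  let L := (Pi.basisFun ℂ (Fin 2)).equiv b (Equiv.refl _)
  have h₀ : L e₀ = b 0 := by
    simpa [e₀] using (Pi.basisFun ℂ (Fin 2)).equiv_apply 0 b (Equiv.refl _)
  have h₁ : L e₁ = b 1 := by
    simpa [e₁] using (Pi.basisFun ℂ (Fin 2)).equiv_apply 1 b (Equiv.refl _)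
  exact ⟨L, L, L, by simp [cfaState, GHZ, hu, hb, h₀, h₁]⟩
end
end

section
/- Let (ℂ², μ, η, δ, ε) be an anti-special commutative Frobenius algebra on ℂ², and let ψ := (δ ⊗ id)(δ(η 1)) ∈ ℂ² ⊗ ℂ² ⊗ ℂ² be its induced tripartite state. Then ψ is SLOCC-equivalent to the W state: there exist bijective ℂ-linear maps L₁, L₂, L₃ : ℂ² → ℂ² such that ψ = (L₁ ⊗ L₂ ⊗ L₃)|W⟩. -/
open TensorProduct

noncomputable section

variable {H : Type*} [AddCommGroup H] [Module ℂ H]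

/-- A CFA is anti-special if, with `c := ε(μ(δ(η 1)))`,
`c • μ(δ x) = ε(μ(δ x)) • μ(δ(η 1))` for all `x`. -/
def IsAntiSpecial (μ : H ⊗[ℂ] H →ₗ[ℂ] H) (η : ℂ →ₗ[ℂ] H)
    (δ : H →ₗ[ℂ] H ⊗[ℂ] H) (ε : H →ₗ[ℂ] ℂ) : Prop :=
  ∀ x : H, ε (μ (δ (η 1))) • μ (δ x) = ε (μ (δ x)) • μ (δ (η 1))
/-- The W state `e₁⊗e₀⊗e₀ + e₀⊗e₁⊗e₀ + e₀⊗e₀⊗e₁`. -/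
def Wstate : ((Fin 2 → ℂ) ⊗[ℂ] (Fin 2 → ℂ)) ⊗[ℂ] (Fin 2 → ℂ) :=
  (e₁ ⊗ₜ[ℂ] e₀) ⊗ₜ[ℂ] e₀ + (e₀ ⊗ₜ[ℂ] e₁) ⊗ₜ[ℂ] e₀ + (e₀ ⊗ₜ[ℂ] e₀) ⊗ₜ[ℂ] e₁

namespace IsCFA

variable {μ : H ⊗[ℂ] H →ₗ[ℂ] H} {η : ℂ →ₗ[ℂ] H} {δ : H →ₗ[ℂ] H ⊗[ℂ] H} {ε : H →ₗ[ℂ] ℂ}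

theorem comul_eq_map_mul_left (hF : IsCFA μ η δ ε) (x : H) :
    δ x = TensorProduct.map (μ ∘ₗ TensorProduct.mk ℂ H H x) LinearMap.id (δ (η 1)) := by
  have h := hF.frob_left x (η 1)
  rw [hF.unit_right] at h
  rw [← h, TensorProduct.map_tmul]
  induction δ (η 1) with
  | zero => simp
  | tmul a b => simp
  | add a b ha hb => simp only [tmul_add, map_add, ha, hb]

theorem comul_eq_map_mul_right (hF : IsCFA μ η δ ε) (x : H) :
    δ x = TensorProduct.map LinearMap.id (μ ∘ₗ TensorProduct.mk ℂ H H x) (δ (η 1)) := by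
  have h := hF.frob_right (η 1) x
  rw [hF.unit_left] at h
  rw [← h, TensorProduct.map_tmul]
  induction δ (η 1) with
  | zero => simp
  | tmul a b => simp [hF.comm x b]
  | add a b ha hb => simp only [add_tmul, map_add, ha, hb]

theorem mul_comul (hF : IsCFA μ η δ ε) (x : H) : μ (δ x) = μ (μ (δ (η 1)) ⊗ₜ x) := by
  rw [hF.comul_eq_map_mul_right x]
  induction δ (η 1) with
  | zero => simp
  | tmul a b => simp [hF.assoc, hF.comm x b]
  | add a b ha hb => simp only [add_tmul, map_add, ha, hb]

end IsCFA

/-- Expansion of a tensor in `H ⊗ H` with respect to a two-element basis of `H`. -/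
theorem exists_tensor_expansion (b : Module.Basis (Fin 2) ℂ H) (T : H ⊗[ℂ] H) :
    ∃ p q r s : ℂ, T = p • (b 0 ⊗ₜ[ℂ] b 0) + q • (b 0 ⊗ₜ[ℂ] b 1) +
      r • (b 1 ⊗ₜ[ℂ] b 0) + s • (b 1 ⊗ₜ[ℂ] b 1) := by
  have h := (b.tensorProduct b).sum_repr T
  simp only [Fintype.sum_prod_type, Fin.sum_univ_two, Module.Basis.tensorProduct_apply] at h
  exact ⟨_, _, _, _, by rw [← h]; abel⟩

/-- On a two-dimensional commutative Frobenius algebra the loop `ε ∘ μ ∘ δ ∘ η` equals `2`. -/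
theorem IsCFA.counit_mul_comul_unit (b : Module.Basis (Fin 2) ℂ H)
    {μ : H ⊗[ℂ] H →ₗ[ℂ] H} {η : ℂ →ₗ[ℂ] H} {δ : H →ₗ[ℂ] H ⊗[ℂ] H} {ε : H →ₗ[ℂ] ℂ}
    (hF : IsCFA μ η δ ε) : ε (μ (δ (η 1))) = 2 := by
  obtain ⟨p, q, r, s, hT⟩ := exists_tensor_expansion b (δ (η 1))
  have key : ∀ x, x = (p * ε (μ (x ⊗ₜ b 0)) + q * ε (μ (x ⊗ₜ b 1))) • b 0 +
      (r * ε (μ (x ⊗ₜ b 0)) + s * ε (μ (x ⊗ₜ b 1))) • b 1 := by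
    intro x
    conv_lhs => rw [← hF.counit_right x, hF.comul_eq_map_mul_right x, hT]
    simp
    module
  have h0 := congrArg (b.coord 0) (key (b 0))
  have h1 := congrArg (b.coord 1) (key (b 1))
  simp [hF.comm (b 1) (b 0)] at h0 h1
  rw [hT]
  simp [hF.comm (b 1) (b 0)]
  linear_combination -h0 - h1

/-- The unit and the handle `μ (δ (η 1))` of a two-dimensional anti-special commutative
Frobenius algebra are linearly independent. -/
theorem IsAntiSpecial.linearIndependent_unit_handle (b : Module.Basis (Fin 2) ℂ H)
    {μ : H ⊗[ℂ] H →ₗ[ℂ] H} {η : ℂ →ₗ[ℂ] H} {δ : H →ₗ[ℂ] H ⊗[ℂ] H} {ε : H →ₗ[ℂ] ℂ}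
    (hF : IsCFA μ η δ ε) (hA : IsAntiSpecial μ η δ ε) :
    LinearIndependent ℂ ![η 1, μ (δ (η 1))] := by
  have hc := hF.counit_mul_comul_unit b
  have hw : ∀ x, μ (μ (δ (η 1)) ⊗ₜ x) = (ε (μ (δ x)) / 2) • μ (δ (η 1)) := by
    intro x
    have h := hA x
    rw [hc] at h
    rw [← hF.mul_comul, div_eq_inv_mul, mul_smul, ← h, smul_smul]
    norm_num
  set w := μ (δ (η 1)) with hwdef
  have hw0 : w ≠ 0 := by rintro h; simp [h] at hc
  have hu0 : η 1 ≠ 0 := by rintro h; simp [hwdef, h] at hw0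
  rw [LinearIndependent.pair_iff' hu0]
  intro a ha
  have ha0 : a ≠ 0 := by rintro rfl; simp at ha; exact hw0 ha.symm
  have hx : ∀ x, x = (ε (μ (δ x)) / 2) • η 1 := by
    intro x
    have h := hw x
    rw [← ha, ← smul_tmul', map_smul, hF.unit_left, smul_comm] at h
    exact smul_right_injective H ha0 h
  have h00 := congrArg (b.coord 0) (hx (b 0))
  have h01 := congrArg (b.coord 1) (hx (b 0))
  have h11 := congrArg (b.coord 1) (hx (b 1))
  simp only [map_smul, smul_eq_mul] at h00 h01 h11
  simp only [Module.Basis.coord_apply, Module.Basis.repr_self, Finsupp.single_eq_same, ne_eq,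
    Fin.isValue, one_ne_zero, not_false_eq_true, Finsupp.single_eq_of_ne]
    at h00 h01 h11
  rcases mul_eq_zero.mp h01.symm with h | h
  · simp [h] at h00
  · simp [h] at h11

/-- A two-dimensional anti-special commutative Frobenius algebra has a basis `u, w`, with `u` its
unit, in which the comultiplication takes a normal form. -/
theorem IsAntiSpecial.exists_basis_comul (b : Module.Basis (Fin 2) ℂ H)
    {μ : H ⊗[ℂ] H →ₗ[ℂ] H} {η : ℂ →ₗ[ℂ] H} {δ : H →ₗ[ℂ] H ⊗[ℂ] H} {ε : H →ₗ[ℂ] ℂ}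
    (hF : IsCFA μ η δ ε) (hA : IsAntiSpecial μ η δ ε) :
    ∃ (B : Module.Basis (Fin 2) ℂ H) (s : ℂ), B 0 = η 1 ∧
      δ (B 1) = (1 / 2 : ℂ) • (B 1 ⊗ₜ[ℂ] B 1) ∧
      δ (B 0) = (1 / 2 : ℂ) • (B 0 ⊗ₜ[ℂ] B 1 + B 1 ⊗ₜ[ℂ] B 0) + s • (B 1 ⊗ₜ[ℂ] B 1) := by
  have hc := hF.counit_mul_comul_unit b
  have hcard : Fintype.card (Fin 2) = Module.finrank ℂ H :=
    (Module.finrank_eq_card_basis b).symm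
  let B := basisOfLinearIndependentOfCardEqFinrank
    (hA.linearIndependent_unit_handle b hF) hcard
  have hB0 : B 0 = η 1 := by simp [B]
  have hB1 : B 1 = μ (δ (η 1)) := by simp [B]
  obtain ⟨a, haa⟩ : ∃ a : ℂ, μ (B 1 ⊗ₜ B 1) = a • B 1 := by
    refine ⟨ε (μ (δ (B 1))) / 2, ?_⟩
    have h := hA (B 1)
    rw [hc, hF.mul_comul, ← hB1] at h
    rw [hF.mul_comul, ← hB1, div_eq_inv_mul, mul_smul, ← h, smul_smul]
    norm_num
  have hu : ∀ x, μ (B 0 ⊗ₜ x) = x := fun x => by rw [hB0, hF.unit_left]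
  have hu' : ∀ x, μ (x ⊗ₜ B 0) = x := fun x => by rw [hB0, hF.unit_right]
  obtain ⟨p, q, r, s, hT⟩ := exists_tensor_expansion B (δ (η 1))
  have hL : δ (B 1) = (p + a * r) • (B 1 ⊗ₜ[ℂ] B 0) + (q + a * s) • (B 1 ⊗ₜ[ℂ] B 1) := by
    rw [hF.comul_eq_map_mul_left, hT]
    simp [hu', haa, ← smul_tmul']
    module
  have hR : δ (B 1) = (p + a * q) • (B 0 ⊗ₜ[ℂ] B 1) + (r + a * s) • (B 1 ⊗ₜ[ℂ] B 1) := by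
    rw [hF.comul_eq_map_mul_right, hT]
    simp [hu', haa]
    module
  have hw : B 1 = p • B 0 + (q + r + a * s) • B 1 := by
    conv_lhs => rw [hB1, hT]
    simp [hu, hu', haa]
    module
  have hp := congrArg (B.coord 0) hw
  have hqr := congrArg (B.coord 1) hw
  have h01 := congrArg (fun T => (B.tensorProduct B).repr T (0, 1)) (hL.symm.trans hR)
  have h11 := congrArg (fun T => (B.tensorProduct B).repr T (1, 1)) (hL.symm.trans hR)
  simp at hp hqr h01 h11
  subst hp
  have ha : a = 0 := by
    by_contra ha
    have hq : q = 0 := by simpa [ha] using h01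
    have hr : r = 0 := by linear_combination hq - h11
    have h := hF.counit_right (η 1)
    rw [hT, ← hB0, hq, hr] at h
    have h' := congrArg (B.coord 0) h
    simp at h'
  subst ha
  have hq : q = 1 / 2 := by linear_combination (1 / 2 : ℂ) * h11 - (1 / 2 : ℂ) * hqr
  have hr : r = 1 / 2 := by linear_combination -(1 / 2 : ℂ) * h11 - (1 / 2 : ℂ) * hqr
  refine ⟨B, s, hB0, ?_, ?_⟩
  · rw [hL, hq]
    module
  · rw [hB0, hT, hq, hr, hB0]
    module

/-- The induced tripartite state of an anti-special commutative
Frobenius algebra on `ℂ²` is SLOCC-equivalent to the W state. -/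
theorem acfa_state_slocc_w
    (μ : (Fin 2 → ℂ) ⊗[ℂ] (Fin 2 → ℂ) →ₗ[ℂ] (Fin 2 → ℂ)) (η : ℂ →ₗ[ℂ] (Fin 2 → ℂ))
    (δ : (Fin 2 → ℂ) →ₗ[ℂ] (Fin 2 → ℂ) ⊗[ℂ] (Fin 2 → ℂ)) (ε : (Fin 2 → ℂ) →ₗ[ℂ] ℂ)
    (hF : IsCFA μ η δ ε) (hA : IsAntiSpecial μ η δ ε) :
    ∃ L₁ L₂ L₃ : (Fin 2 → ℂ) ≃ₗ[ℂ] (Fin 2 → ℂ),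
      cfaState η δ =
        TensorProduct.map (TensorProduct.map L₁.toLinearMap L₂.toLinearMap)
          L₃.toLinearMap Wstate := by
  obtain ⟨B, s, hB0, h1, h0⟩ := hA.exists_basis_comul (Pi.basisFun ℂ (Fin 2)) hF
  let f : (Fin 2 → ℂ) →ₗ[ℂ] (Fin 2 → ℂ) :=
    (Pi.basisFun ℂ (Fin 2)).constr ℂ ![B 1, (1 / 4 : ℂ) • B 0 + (s / 3) • B 1]
  have hf0 : f e₀ = B 1 := by
    rw [e₀, ← Pi.basisFun_apply]
    exact (Pi.basisFun ℂ (Fin 2)).constr_basis ℂ _ 0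
  have hf1 : f e₁ = (1 / 4 : ℂ) • B 0 + (s / 3) • B 1 := by
    rw [e₁, ← Pi.basisFun_apply]
    exact (Pi.basisFun ℂ (Fin 2)).constr_basis ℂ _ 1
  have hsurj : Function.Surjective f := by
    rw [← LinearMap.range_eq_top, eq_top_iff, ← B.span_eq, Submodule.span_le]
    rintro _ ⟨i, rfl⟩
    fin_cases i
    · exact ⟨(4 : ℂ) • e₁ - (4 * s / 3) • e₀, by
        rw [map_sub, map_smul, map_smul, hf0, hf1]
        simp only [Fin.zero_eta]
        module⟩
    · exact ⟨e₀, hf0⟩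
  let L := LinearEquiv.ofBijective f ⟨LinearMap.injective_iff_surjective.mpr hsurj, hsurj⟩
  have hL : L.toLinearMap = f := rfl
  refine ⟨L, L, L, ?_⟩
  rw [hL, cfaState, ← hB0, h0, Wstate]
  simp only [map_add, map_smul, map_tmul, hf0, hf1, h0, h1, LinearMap.id_apply, add_tmul, tmul_add,
    ← smul_tmul', tmul_smul, smul_add, smul_smul]
  module
end
end

section
/- Let μ : ℂ² ⊗ ℂ² → ℂ² and η : ℂ → ℂ² be ℂ-linear maps such that μ is associative (μ∘(μ⊗id) = μ∘(id⊗μ)) and η is a two-sided unit (μ(η(1) ⊗ x) = x = μ(x ⊗ η(1)) for all x). Then there exist ℂ-linear maps δ : ℂ² → ℂ² ⊗ ℂ² and ε : ℂ² → ℂ such that (ℂ², μ, η, δ, ε) is a commutative Frobenius algebra. -/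
open TensorProduct

noncomputable section

variable {H : Type*} [AddCommGroup H] [Module ℂ H]

set_option linter.unusedSimpArgs false in
/-- A unital associative multiplication with unit `u` on a space with basis `(u, w)` and
`w * w = a • u + b • w` extends to a commutative Frobenius algebra, with counit the coordinate
along `w` and comultiplication dual to the multiplication under the resulting Frobenius form. -/
theorem isCFA_of_basis (μ : H ⊗[ℂ] H →ₗ[ℂ] H) (η : ℂ →ₗ[ℂ] H)
    (hassoc : ∀ x y z : H, μ (μ (x ⊗ₜ[ℂ] y) ⊗ₜ[ℂ] z) = μ (x ⊗ₜ[ℂ] μ (y ⊗ₜ[ℂ] z)))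
    (hunit_left : ∀ x : H, μ (η 1 ⊗ₜ[ℂ] x) = x)
    (hunit_right : ∀ x : H, μ (x ⊗ₜ[ℂ] η 1) = x)
    (B : Module.Basis (Fin 2) ℂ H) (hB : B 0 = η 1) :
    ∃ (δ : H →ₗ[ℂ] H ⊗[ℂ] H) (ε : H →ₗ[ℂ] ℂ), IsCFA μ η δ ε := by
  obtain ⟨u, hu⟩ : ∃ u, u = B 0 := ⟨_, rfl⟩
  obtain ⟨w, hw⟩ : ∃ w, w = B 1 := ⟨_, rfl⟩
  have hηu : η 1 = u := by rw [hu, hB]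
  have hx : ∀ x : H, ∃ s t : ℂ, x = s • u + t • w := fun x =>
    ⟨B.repr x 0, B.repr x 1, by rw [hu, hw, ← Fin.sum_univ_two (fun i => B.repr x i • B i),
      B.sum_repr]⟩
  obtain ⟨a, b, hab⟩ := hx (μ (w ⊗ₜ[ℂ] w))
  obtain ⟨δ, hδ⟩ : ∃ δ : H →ₗ[ℂ] H ⊗[ℂ] H,
      δ = B.constr ℂ ![u ⊗ₜ w + w ⊗ₜ u - b • (u ⊗ₜ u), w ⊗ₜ w + a • (u ⊗ₜ u)] := ⟨_, rfl⟩
  obtain ⟨ε, hε⟩ : ∃ ε : H →ₗ[ℂ] ℂ, ε = B.constr ℂ ![0, 1] := ⟨_, rfl⟩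
  have hδu : δ u = u ⊗ₜ w + w ⊗ₜ u - b • (u ⊗ₜ u) := by
    rw [hδ, hu, B.constr_basis]
    rfl
  have hδw : δ w = w ⊗ₜ w + a • (u ⊗ₜ u) := by
    rw [hδ, hw, B.constr_basis]
    rfl
  have hεu : ε u = 0 := by rw [hε, hu, B.constr_basis]; rfl
  have hεw : ε w = 1 := by rw [hε, hw, B.constr_basis]; rfl
  rw [hηu] at hunit_left hunit_right
  clear hδ hε hu hw hB
  refine ⟨δ, ε, hassoc, ?_, by rwa [hηu], by rwa [hηu], ?_, ?_, ?_, ?_, ?_, ?_⟩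
  all_goals
    intro x
    obtain ⟨s, t, rfl⟩ := hx x
    try
      intro y
      obtain ⟨p, q, rfl⟩ := hx y
    simp only [map_add, map_sub, map_smul, add_tmul, tmul_add, sub_tmul, tmul_sub, ← smul_tmul',
      tmul_smul, TensorProduct.map_tmul, TensorProduct.assoc_tmul, TensorProduct.assoc_symm_tmul,
      TensorProduct.comm_tmul, TensorProduct.lid_tmul, TensorProduct.rid_tmul, LinearMap.id_apply,
      hδu, hδw, hεu, hεw, hunit_left, hunit_right, hab]
    module

/-- Every unital associative algebra structure `(μ, η)` on `ℂ²`
extends to a commutative Frobenius algebra. -/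
theorem unital_algebra_extends_to_cfa
    (μ : (Fin 2 → ℂ) ⊗[ℂ] (Fin 2 → ℂ) →ₗ[ℂ] (Fin 2 → ℂ)) (η : ℂ →ₗ[ℂ] (Fin 2 → ℂ))
    (hassoc : ∀ x y z : Fin 2 → ℂ,
      μ (μ (x ⊗ₜ[ℂ] y) ⊗ₜ[ℂ] z) = μ (x ⊗ₜ[ℂ] μ (y ⊗ₜ[ℂ] z)))
    (hunit_left : ∀ x : Fin 2 → ℂ, μ (η 1 ⊗ₜ[ℂ] x) = x)
    (hunit_right : ∀ x : Fin 2 → ℂ, μ (x ⊗ₜ[ℂ] η 1) = x) :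
    ∃ (δ : (Fin 2 → ℂ) →ₗ[ℂ] (Fin 2 → ℂ) ⊗[ℂ] (Fin 2 → ℂ)) (ε : (Fin 2 → ℂ) →ₗ[ℂ] ℂ),
      IsCFA μ η δ ε := by
  have hne : η 1 ≠ 0 := by
    intro h
    have h1 := hunit_left ![1, 0]
    rw [h, zero_tmul, map_zero] at h1
    simpa using congrFun h1 0
  obtain ⟨w, hw⟩ := exists_linearIndependent_pair_of_one_lt_finrank
    (R := ℂ) (M := Fin 2 → ℂ) (by simp) hne
  refine isCFA_of_basis μ η hassoc hunit_left hunit_right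
    (basisOfLinearIndependentOfCardEqFinrank hw (by simp)) ?_
  simp
end
end

section
/- Let (H, μ, η, δ, ε) be an anti-special commutative Frobenius algebra on a complex vector space H, and write c := ε(μ(δ(η 1))) ∈ ℂ and ℓ := μ(δ(η 1)) ∈ H. Then c • δ(ℓ) = ℓ ⊗ ℓ in H ⊗ H. -/
open TensorProduct

noncomputable section

variable {H : Type*} [AddCommGroup H] [Module ℂ H]

/-- The handle operator `μ ∘ δ` is multiplication by the handle element `μ (δ (η 1))`. -/
theorem IsCFA.mul_comul_s17 {μ : H ⊗[ℂ] H →ₗ[ℂ] H} {η : ℂ →ₗ[ℂ] H} {δ : H →ₗ[ℂ] H ⊗[ℂ] H}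
    {ε : H →ₗ[ℂ] ℂ} (hF : IsCFA μ η δ ε) (x : H) :
    μ (δ x) = μ (μ (δ (η 1)) ⊗ₜ[ℂ] x) := by
  have mul_assoc_tmul (t : H ⊗[ℂ] H) :
      μ (TensorProduct.map LinearMap.id μ (TensorProduct.assoc ℂ H H H (t ⊗ₜ[ℂ] x))) =
        μ (μ t ⊗ₜ[ℂ] x) := by
    induction t with
    | zero => simp
    | tmul a b => simp [hF.assoc]
    | add a b ha hb => simp only [TensorProduct.add_tmul, map_add, ha, hb]
  have h := hF.frob_right (η 1) x
  rw [hF.unit_left, TensorProduct.map_tmul, LinearMap.id_apply] at h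
  rw [← h, mul_assoc_tmul]

/-- Comultiplying the handle element amounts to inserting a handle on the left leg of the
copairing `δ (η 1)`. -/
theorem IsCFA.comul_handle {μ : H ⊗[ℂ] H →ₗ[ℂ] H} {η : ℂ →ₗ[ℂ] H} {δ : H →ₗ[ℂ] H ⊗[ℂ] H}
    {ε : H →ₗ[ℂ] ℂ} (hF : IsCFA μ η δ ε) :
    δ (μ (δ (η 1))) = TensorProduct.map (μ ∘ₗ δ) LinearMap.id (δ (η 1)) := by
  have map_mul_tmul (t : H ⊗[ℂ] H) :
      TensorProduct.map μ LinearMap.id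
          ((TensorProduct.assoc ℂ H H H).symm (μ (δ (η 1)) ⊗ₜ[ℂ] t)) =
        TensorProduct.map (μ ∘ₗ δ) LinearMap.id t := by
    induction t with
    | zero => simp
    | tmul a b => simp [hF.mul_comul_s17 a]
    | add a b ha hb => simp only [TensorProduct.tmul_add, map_add, ha, hb]
  have h := hF.frob_left (μ (δ (η 1))) (η 1)
  rw [hF.unit_right, TensorProduct.map_tmul, LinearMap.id_apply] at h
  rw [← h, map_mul_tmul]

/-- In an anti-special algebra, the handle operator on the left leg of a tensor factors, up to the
scalar `ε (μ (δ (η 1)))`, through the handle element. -/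
theorem IsAntiSpecial.smul_map_handle {μ : H ⊗[ℂ] H →ₗ[ℂ] H} {η : ℂ →ₗ[ℂ] H}
    {δ : H →ₗ[ℂ] H ⊗[ℂ] H} {ε : H →ₗ[ℂ] ℂ} (hA : IsAntiSpecial μ η δ ε) (t : H ⊗[ℂ] H) :
    ε (μ (δ (η 1))) • TensorProduct.map (μ ∘ₗ δ) LinearMap.id t =
      μ (δ (η 1)) ⊗ₜ[ℂ] TensorProduct.lid ℂ H
        (TensorProduct.map ε LinearMap.id (TensorProduct.map (μ ∘ₗ δ) LinearMap.id t)) := by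
  induction t with
  | zero => simp
  | tmul a b =>
    simp only [TensorProduct.map_tmul, LinearMap.comp_apply, LinearMap.id_apply,
      TensorProduct.lid_tmul]
    rw [TensorProduct.smul_tmul', hA a, TensorProduct.smul_tmul]
  | add a b ha hb => simp only [map_add, smul_add, TensorProduct.tmul_add, ha, hb]

/-- For an anti-special commutative Frobenius algebra, with
`c := ε (μ (δ (η 1)))` and `ℓ := μ (δ (η 1))`, one has `c • δ ℓ = ℓ ⊗ ℓ`. -/
theorem acfa_delta_copies_loop
    (μ : H ⊗[ℂ] H →ₗ[ℂ] H) (η : ℂ →ₗ[ℂ] H) (δ : H →ₗ[ℂ] H ⊗[ℂ] H) (ε : H →ₗ[ℂ] ℂ)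
    (hF : IsCFA μ η δ ε) (hA : IsAntiSpecial μ η δ ε) :
    ε (μ (δ (η 1))) • δ (μ (δ (η 1))) = μ (δ (η 1)) ⊗ₜ[ℂ] μ (δ (η 1)) := by
  rw [hF.comul_handle, hA.smul_map_handle, ← hF.comul_handle, hF.counit_left]
end
end
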